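/- arXiv:1701.08731 — 6 statements merged into one kernel-verified Lean document; each statement's English description precedes it below -/
import Mathlib

section
/- Let A : ℕ → ℝ be a function defined on the positive integers such that A(s·t) = A(s) + A(t) for all positive integers s, t, and such that A is strictly increasing (A(n) < A(n+1) for all n ≥ 1). Then there exists a constant K > 0 such that A(t) = K · log t for every positive integer t. -/
theorem apply_pow_of_mul_eq_add {A : ℕ → ℝ}
    (hadd : ∀ s t : ℕ, 0 < s → 0 < t → A (s * t) = A s + A t)
    {s : ℕ} (hs : 0 < s) (n : ℕ) : A (s ^ n) = n * A s := by
  induction n with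
  | zero =>
    have h := hadd 1 1 one_pos one_pos
    simp only [mul_one] at h
    simp only [pow_zero, Nat.cast_zero, zero_mul]
    linarith
  | succ n ih =>
    rw [pow_succ, hadd _ _ (pow_pos hs n) hs, ih]
    push_cast
    ring

theorem apply_le_apply_of_lt_succ {A : ℕ → ℝ}
    (hmono : ∀ n : ℕ, 1 ≤ n → A n < A (n + 1)) {a b : ℕ} (ha : 1 ≤ a) (hab : a ≤ b) :
    A a ≤ A b := by
  induction b, hab using Nat.le_induction with
  | base => exact le_rfl
  | succ b hb ih => exact ih.trans (hmono b (ha.trans hb)).le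

theorem nonpos_of_forall_nat_mul_le {x C : ℝ} (h : ∀ n : ℕ, n * x ≤ C) : x ≤ 0 := by
  by_contra! hx
  obtain ⟨n, hn⟩ := exists_nat_gt (C / x)
  rw [div_lt_iff₀ hx] at hn
  exact (h n).not_gt hn

/-- Shannon's key lemma: a strictly increasing function on the positive integers
satisfying `A (s*t) = A s + A t` is a positive multiple of the logarithm. -/
theorem additive_increasing_is_log (A : ℕ → ℝ)
    (hadd : ∀ s t : ℕ, 0 < s → 0 < t → A (s * t) = A s + A t)
    (hmono : ∀ n : ℕ, 1 ≤ n → A n < A (n + 1)) :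
    ∃ K : ℝ, 0 < K ∧ ∀ t : ℕ, 0 < t → A t = K * Real.log t := by
  have hA2 : 0 < A 2 := by
    have h1 := apply_pow_of_mul_eq_add hadd one_pos 0
    have h2 := hmono 1 le_rfl
    norm_num at h1 h2
    linarith
  have hlog2 : 0 < Real.log 2 := Real.log_pos one_lt_two
  refine ⟨A 2 / Real.log 2, div_pos hA2 hlog2, fun t ht ↦ ?_⟩
  -- Both `A` and `log` trap `t ^ n` between the same consecutive powers of two.
  have key (n : ℕ) : n * (A t * Real.log 2 - A 2 * Real.log t) ≤ A 2 * Real.log 2 ∧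
      n * (A 2 * Real.log t - A t * Real.log 2) ≤ A 2 * Real.log 2 := by
    have htn : 0 < t ^ n := pow_pos ht n
    obtain ⟨m, hm⟩ : ∃ m, m = Nat.log 2 (t ^ n) := ⟨_, rfl⟩
    have hlo : 2 ^ m ≤ t ^ n := hm ▸ Nat.pow_log_le_self 2 htn.ne'
    have hhi : t ^ n ≤ 2 ^ (m + 1) := hm ▸ (Nat.lt_pow_succ_log_self one_lt_two _).le
    have hAlo := apply_le_apply_of_lt_succ hmono Nat.one_le_two_pow hlo
    have hAhi := apply_le_apply_of_lt_succ hmono htn hhi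
    have hLlo : Real.log ((2 : ℝ) ^ m) ≤ Real.log ((t : ℝ) ^ n) :=
      Real.log_le_log (by positivity) (mod_cast hlo)
    have hLhi : Real.log ((t : ℝ) ^ n) ≤ Real.log ((2 : ℝ) ^ (m + 1)) :=
      Real.log_le_log (by positivity) (mod_cast hhi)
    rw [apply_pow_of_mul_eq_add hadd two_pos, apply_pow_of_mul_eq_add hadd ht] at hAlo hAhi
    rw [Real.log_pow, Real.log_pow] at hLlo hLhi
    push_cast at hAhi hLhi
    constructor
    · linarith [mul_le_mul_of_nonneg_right hAhi hlog2.le, mul_le_mul_of_nonneg_left hLlo hA2.le]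
    · linarith [mul_le_mul_of_nonneg_right hAlo hlog2.le, mul_le_mul_of_nonneg_left hLhi hA2.le]
  have hle := nonpos_of_forall_nat_mul_le fun n ↦ (key n).1
  have hge := nonpos_of_forall_nat_mul_le fun n ↦ (key n).2
  rw [div_mul_eq_mul_div, eq_div_iff hlog2.ne']
  linarith
end

section
/- Let A : ℕ → ℝ satisfy A(s·t) = A(s) + A(t) for all positive integers s, t and be strictly increasing, and fix integers s, t ≥ 2 and a positive integer n large enough that there is a (unique) m ∈ ℕ with s^m ≤ t^n < s^(m+1). Then |A(t)/A(s) − (log t)/(log s)| < 1/n. -/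
/-- A completely additive function sends powers of a positive integer to multiples. -/
theorem additive_map_pow {A : ℕ → ℝ}
    (hadd : ∀ s t : ℕ, 0 < s → 0 < t → A (s * t) = A s + A t)
    {s : ℕ} (hs : 0 < s) (k : ℕ) : A (s ^ k) = k * A s := by
  induction k with
  | zero =>
    have h := hadd 1 1 one_pos one_pos
    simp only [mul_one] at h
    simp only [pow_zero, Nat.cast_zero, zero_mul]
    linarith
  | succ k ih =>
    rw [pow_succ, hadd _ _ (pow_pos hs k) hs, ih]
    push_cast
    ring

/-- A completely additive, strictly increasing function has its ratio `A t / A s` in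
`[m/n, (m+1)/n)` whenever `s^m ≤ t^n < s^(m+1)`. -/
theorem additive_div_mem_Ico {A : ℕ → ℝ}
    (hadd : ∀ s t : ℕ, 0 < s → 0 < t → A (s * t) = A s + A t)
    (hmono : StrictMonoOn A (Set.Ici 1))
    {s t n m : ℕ} (hs : 2 ≤ s) (ht : 0 < t) (hn : 0 < n)
    (h1 : s ^ m ≤ t ^ n) (h2 : t ^ n < s ^ (m + 1)) :
    A t / A s ∈ Set.Ico ((m : ℝ) / n) ((m + 1) / n) := by
  have hs0 : 0 < s := by omega
  have hA1 : A 1 = 0 := by simpa using additive_map_pow hadd one_pos 0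
  have hAs : 0 < A s := hA1 ▸ hmono Set.self_mem_Ici (Set.mem_Ici.2 hs0) (by omega)
  have hn' : (0 : ℝ) < n := by exact_mod_cast hn
  have hle := hmono.monotoneOn (Set.mem_Ici.2 (pow_pos hs0 m)) (Set.mem_Ici.2 (pow_pos ht n)) h1
  have hlt := hmono (Set.mem_Ici.2 (pow_pos ht n)) (Set.mem_Ici.2 (pow_pos hs0 (m + 1))) h2
  rw [additive_map_pow hadd hs0, additive_map_pow hadd ht] at hle hlt
  push_cast at hlt
  constructor
  · rw [div_le_div_iff₀ hn' hAs]
    linarith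
  · rw [div_lt_div_iff₀ hAs hn']
    linarith

/-- The quantitative estimate in Shannon's argument: both `A t / A s` and
`log t / log s` lie in `[m/n, (m+1)/n)` where `s^m ≤ t^n < s^(m+1)`. -/
theorem shannon_quantitative_estimate (A : ℕ → ℝ)
    (hadd : ∀ s t : ℕ, 0 < s → 0 < t → A (s * t) = A s + A t)
    (hmono : ∀ n : ℕ, 1 ≤ n → A n < A (n + 1))
    (s t n m : ℕ) (hs : 2 ≤ s) (ht : 2 ≤ t) (hn : 1 ≤ n)
    (h1 : s ^ m ≤ t ^ n) (h2 : t ^ n < s ^ (m + 1)) :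
    |A t / A s - Real.log t / Real.log s| < 1 / n := by
  have hA : StrictMonoOn A (Set.Ici 1) := by
    intro a ha b _ hab
    induction b, hab using Nat.le_induction with
    | base => exact hmono a ha
    | succ b hab ih =>
      have ha' : 1 ≤ a := ha
      have hb : 1 ≤ b := by omega
      exact (ih hb).trans (hmono b hb)
  have hlog : StrictMonoOn (fun k : ℕ => Real.log k) (Set.Ici 1) := fun a ha b _ hab =>
    Real.log_lt_log (Nat.cast_pos.2 ha) (Nat.cast_lt.2 hab)
  have hlog_add : ∀ a b : ℕ, 0 < a → 0 < b →
      Real.log (a * b : ℕ) = Real.log a + Real.log b := fun a b ha hb => by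
    rw [Nat.cast_mul, Real.log_mul (by positivity) (by positivity)]
  obtain ⟨hA_le, hA_lt⟩ := additive_div_mem_Ico hadd hA hs (by omega) hn h1 h2
  obtain ⟨hlog_le, hlog_lt⟩ := additive_div_mem_Ico hlog_add hlog hs (by omega) hn h1 h2
  rw [add_div] at hA_lt hlog_lt
  rw [abs_lt]
  constructor <;> linarith
end

section
/- Let n be a positive integer, b > 1, let Q be an invertible n × n real matrix with strictly positive entries whose row sums all equal 1, and let F = Q⁻¹ with entries f(k,l). Let p : Fin n → ℝ satisfy p(i) > 0 for all i and Σ_i p(i) = 1, and set r(j) = Σ_i Q(i,j) · p(i) (so r(j) > 0). Suppose there is a constant C ∈ ℝ such that for every k, Σ_j Q(k,j) · (log_b Q(k,j) − log_b r(j)) = C (the Lagrange stationarity condition). Then C = log_b ( Σ_k b^( Σ_{l,j} f(k,l) · Q(l,j) · log_b Q(l,j) ) ). -/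
/-- Muroga's explicit formula for the Shannon capacity of a discrete channel
with a square invertible transition matrix. -/
theorem muroga_capacity_formula (n : ℕ) (hn : 0 < n) (b : ℝ) (hb : 1 < b)
    (Q : Matrix (Fin n) (Fin n) ℝ) (hQ : IsUnit Q)
    (hQpos : ∀ i j, 0 < Q i j) (hrow : ∀ i, ∑ j, Q i j = 1)
    (p : Fin n → ℝ) (hp : ∀ i, 0 < p i) (hps : ∑ i, p i = 1)
    (r : Fin n → ℝ) (hr : ∀ j, r j = ∑ i, Q i j * p i)
    (C : ℝ)
    (hC : ∀ k, ∑ j, Q k j * (Real.logb b (Q k j) - Real.logb b (r j)) = C) :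
    C = Real.logb b
        (∑ k, b ^ (∑ l, ∑ j, Q⁻¹ k l * Q l j * Real.logb b (Q l j))) := by
  have hb0 : 0 < b := by linarith
  have hr_pos : ∀ j, 0 < r j := fun j => by
    rw [hr]
    exact Finset.sum_pos (fun i _ => mul_pos (hQpos i j) (hp i)) ⟨⟨0, hn⟩, Finset.mem_univ _⟩
  have hr_sum : ∑ j, r j = 1 := by
    simp_rw [hr]
    rw [Finset.sum_comm]
    simp_rw [← Finset.sum_mul, hrow, one_mul, hps]
  -- Since the rows of `Q` sum to one, stationarity is a linear system for `logb b (r j) + C`.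
  have hsystem : (fun l => ∑ j, Q l j * Real.logb b (Q l j)) =
      Q.mulVec fun j => Real.logb b (r j) + C := by
    funext l
    have h := hC l
    simp only [mul_sub, Finset.sum_sub_distrib] at h
    simp only [Matrix.mulVec, dotProduct, mul_add, Finset.sum_add_distrib, ← Finset.sum_mul,
      hrow, one_mul]
    linarith
  have hsolution : ∀ k, ∑ l, ∑ j, Q⁻¹ k l * Q l j * Real.logb b (Q l j) =
      Real.logb b (r k) + C := fun k => by
    have h := congrFun (congrArg Q⁻¹.mulVec hsystem) k
    rw [Matrix.mulVec_mulVec, Matrix.nonsing_inv_mul _ ((Matrix.isUnit_iff_isUnit_det _).mp hQ),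
      Matrix.one_mulVec] at h
    simpa only [Matrix.mulVec, dotProduct, Finset.mul_sum, mul_assoc] using h
  simp_rw [hsolution, Real.rpow_add hb0, Real.rpow_logb hb0 hb.ne' (hr_pos _)]
  rw [← Finset.sum_mul, hr_sum, one_mul, Real.logb_rpow hb0 hb.ne']
end

section
/- Let a, c ∈ (0,1) with a ≠ c, write a' = 1−a, c' = 1−c, and let X₁, X₂ be the solution of the linear system a'·X₁ + a·X₂ = a'·log₂ a' + a·log₂ a, c'·X₁ + c·X₂ = c'·log₂ c' + c·log₂ c. Then log₂(2^X₁ + 2^X₂) = log₂ [ ( a'^(a'c) · a^(ac) / ( c'^(ac') · c^(ac) ) )^(1/(c−a)) + ( c'^(a'c') · c^(a'c) / ( a'^(a'c') · a^(ac') ) )^(1/(c−a)) ]. -/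
/-- A root of a quotient of products of real powers, written as a power of `2`. -/
lemma two_rpow_eq_div_rpow {p q r s i j k l d X : ℝ} (hp : 0 < p) (hq : 0 < q) (hr : 0 < r)
    (hs : 0 < s) (hd : d ≠ 0)
    (h : d * X = i * Real.logb 2 p + j * Real.logb 2 q
      - (k * Real.logb 2 r + l * Real.logb 2 s)) :
    (2 : ℝ) ^ X = ((p ^ i * q ^ j) / (r ^ k * s ^ l)) ^ (1 / d) := by
  have hpi := Real.rpow_pos_of_pos hp i
  have hqj := Real.rpow_pos_of_pos hq j
  have hrk := Real.rpow_pos_of_pos hr k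
  have hsl := Real.rpow_pos_of_pos hs l
  have hpos : 0 < (p ^ i * q ^ j) / (r ^ k * s ^ l) := by positivity
  have hlog : Real.logb 2 (((p ^ i * q ^ j) / (r ^ k * s ^ l)) ^ (1 / d)) = X := by
    rw [Real.logb_rpow_eq_mul_logb_of_pos hpos, Real.logb_div (by positivity) (by positivity),
      Real.logb_mul hpi.ne' hqj.ne', Real.logb_mul hrk.ne' hsl.ne',
      Real.logb_rpow_eq_mul_logb_of_pos hp, Real.logb_rpow_eq_mul_logb_of_pos hq,
      Real.logb_rpow_eq_mul_logb_of_pos hr, Real.logb_rpow_eq_mul_logb_of_pos hs, ← h]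
    field_simp
  rw [← hlog, Real.rpow_logb two_pos (by norm_num) (Real.rpow_pos_of_pos hpos _)]

/-- The closed-form capacity of a binary channel: if `(X₁, X₂)` solves
Muroga's linear system, then `log₂(2^X₁ + 2^X₂)` equals Silverman's explicit
expression in `a` and `c`. -/
theorem binary_channel_capacity_closed_form
    (a c : ℝ) (ha : 0 < a) (ha1 : a < 1) (hc : 0 < c) (hc1 : c < 1)
    (hac : a ≠ c)
    (a' c' X₁ X₂ : ℝ) (ha' : a' = 1 - a) (hc' : c' = 1 - c)
    (h1 : a' * X₁ + a * X₂ = a' * Real.logb 2 a' + a * Real.logb 2 a)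
    (h2 : c' * X₁ + c * X₂ = c' * Real.logb 2 c' + c * Real.logb 2 c) :
    Real.logb 2 ((2:ℝ) ^ X₁ + (2:ℝ) ^ X₂) =
      Real.logb 2
        (((a' ^ (a' * c) * a ^ (a * c)) / (c' ^ (a * c') * c ^ (a * c)))
            ^ (1 / (c - a))
          + ((c' ^ (a' * c') * c ^ (a' * c)) / (a' ^ (a' * c') * a ^ (a * c')))
            ^ (1 / (c - a))) := by
  have hpa : 0 < a' := by linarith
  have hpc : 0 < c' := by linarith
  have hd : c - a ≠ 0 := sub_ne_zero.mpr hac.symm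
  have hdet : c - a = a' * c - a * c' := by rw [ha', hc']; ring
  congr 2
  · refine two_rpow_eq_div_rpow hpa ha hpc hc hd ?_
    rw [hdet]
    linear_combination c * h1 - a * h2
  · refine two_rpow_eq_div_rpow hpc hc hpa ha hd ?_
    rw [hdet]
    linear_combination a' * h2 - c' * h1
end

section
/- Let a, c be real numbers with 0 < a < c < 1. Then (1−a)·(log₂(1−a) − log₂(1−c)) ≥ a·(log₂ c − log₂ a). -/
/-- The tangent line bound for the base-2 logarithm. -/
theorem mul_logb_two_sub_logb_two_le {x y : ℝ} (hx : 0 < x) (hy : 0 < y) :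
    x * (Real.logb 2 y - Real.logb 2 x) ≤ (y - x) / Real.log 2 := by
  rw [← Real.logb_div hy.ne' hx.ne', Real.logb, ← mul_div_assoc]
  have hlog : 0 < Real.log 2 := Real.log_pos one_lt_two
  gcongr
  calc x * Real.log (y / x) ≤ x * (y / x - 1) := by
        gcongr
        exact Real.log_le_sub_one_of_pos (div_pos hy hx)
    _ = y - x := by field_simp

/-- The feasibility inequality for the optimal input distribution of a binary
channel: `(1-a)(log₂(1-a) - log₂(1-c)) ≥ a(log₂ c - log₂ a)` for `0 < a < c < 1`. -/
theorem feasibility_inequality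
    (a c : ℝ) (ha : 0 < a) (hac : a < c) (hc1 : c < 1) :
    (1 - a) * (Real.logb 2 (1 - a) - Real.logb 2 (1 - c)) ≥
      a * (Real.logb 2 c - Real.logb 2 a) := by
  have h₁ := mul_logb_two_sub_logb_two_le ha (ha.trans hac)
  have h₂ := mul_logb_two_sub_logb_two_le (sub_pos.2 (hac.trans hc1)) (sub_pos.2 hc1)
  have h₃ : (1 - c - (1 - a)) / Real.log 2 = -((c - a) / Real.log 2) := by ring
  linarith
end

section
/- Suppose that for every n ≥ 1, H assigns a real number to each probability vector p ∈ Δ^{n−1} (i.e. p : Fin n → ℝ with p(i) ≥ 0 and Σ p(i) = 1), and that H satisfies: (1) whenever p ∈ Δ^{n−1} and p' ∈ Δ^{n'−1} and there is a bijection between {i : p(i) > 0} and {i' : p'(i') > 0} matching probabilities, H(p) = H(p'); (2) for each fixed n, H is continuous on Δ^{n−1} with respect to the subspace topology from ℝⁿ; (3) writing u_n for the uniform vector (1/n, …, 1/n) ∈ Δ^{n−1}, H(u_n) < H(u_{n+1}) for all n ≥ 1; (4) for every p ∈ Δ^{n−1} and every partition 𝓔 of Fin n, H(p) = H(p_𝓔)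 + Σ over parts E ∈ 𝓔 with P(E) = Σ_{i ∈ E} p(i) > 0 of P(E) · H(q_E), where p_𝓔 is the vector of part probabilities (P(E))_{E ∈ 𝓔} and q_E is the conditional vector (p(i)/P(E))_{i ∈ E}. Then there exist constants K > 0 and b > 1 such that for every n and every p ∈ Δ^{n−1}, H(p) = −K · Σ_{i : p(i) > 0} p(i) · log_b p(i). Conversely, every function of this form satisfies (1)–(4). -/
/-- `H` depends only on the positive probabilities, up to relabelling. -/
def SupportInvariant (H : ∀ (α : Type) [Fintype α], (α → ℝ) → ℝ) : Prop :=
  ∀ (α : Type) [Fintype α] (β : Type) [Fintype β] (p : α → ℝ) (p' : β → ℝ),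
    (∀ i, 0 ≤ p i) → ∑ i, p i = 1 → (∀ j, 0 ≤ p' j) → ∑ j, p' j = 1 →
    ∀ f : {i : α // 0 < p i} ≃ {j : β // 0 < p' j},
      (∀ i, p' (f i).1 = p i.1) → H α p = H β p'

/-- Shannon's grouping axiom. -/
def Grouping (H : ∀ (α : Type) [Fintype α], (α → ℝ) → ℝ) : Prop :=
  ∀ (α : Type) [Fintype α] [DecidableEq α] (p : α → ℝ),
    (∀ i, 0 ≤ p i) → ∑ i, p i = 1 →
    ∀ 𝓔 : Finpartition (Finset.univ : Finset α),
      H α p = H ↥𝓔.parts (fun E => ∑ i ∈ E.1, p i) +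
        ∑ E ∈ 𝓔.parts,
          (if 0 < ∑ i ∈ E, p i then
            (∑ i ∈ E, p i) * H ↥E (fun i => p i.1 / ∑ i' ∈ E, p i')
          else 0)

/-- The value of `H` on the uniform distribution on `n` points. -/
noncomputable def uniformValue (H : ∀ (α : Type) [Fintype α], (α → ℝ) → ℝ) (n : ℕ) : ℝ :=
  H (Fin n) (fun _ => (n : ℝ)⁻¹)

/-- The Shannon entropy in nats of a finite probability vector. -/
noncomputable def shannonEntropy {α : Type} [Fintype α] (p : α → ℝ) : ℝ :=
  ∑ i, Real.negMulLog (p i)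

section Uniqueness

variable {H : ∀ (α : Type) [Fintype α], (α → ℝ) → ℝ}

lemma SupportInvariant.congr_equiv (hinv : SupportInvariant H) {α β : Type} [Fintype α]
    [Fintype β] {p : α → ℝ} {p' : β → ℝ} (hp : ∀ i, 0 ≤ p i) (hsum : ∑ i, p i = 1)
    (e : α ≃ β) (he : ∀ i, p' (e i) = p i) : H α p = H β p' := by
  refine hinv α β p p' hp hsum (fun j => ?_) ?_
    (e.subtypeEquiv fun i => by rw [he]) fun i => he i.1
  · rw [← e.apply_symm_apply j, he]
    exact hp _
  · rw [← hsum, ← e.sum_comp]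
    exact Finset.sum_congr rfl fun i _ => he i

lemma SupportInvariant.eq_uniformValue (hinv : SupportInvariant H) {α : Type} [Fintype α]
    {n : ℕ} (hn : n ≠ 0) (hcard : Fintype.card α = n) :
    H α (fun _ => (n : ℝ)⁻¹) = uniformValue H n := by
  refine hinv.congr_equiv (fun _ => by positivity) ?_
    (Fintype.equivFinOfCardEq hcard) fun _ => rfl
  have : (n : ℝ) ≠ 0 := Nat.cast_ne_zero.mpr hn
  simp [hcard, this]

/-- The partition of a sigma type with nonempty fibres into its fibres. -/
def fiberPartition {α : Type} [Fintype α] [DecidableEq α] (n : α → ℕ) (hn : ∀ a, n a ≠ 0) :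
    Finpartition (Finset.univ : Finset (Σ a, Fin (n a))) :=
  Finpartition.ofExistsUnique
    (Finset.univ.image fun a => Finset.univ.filter fun x : Σ a, Fin (n a) => x.1 = a)
    (fun _ _ => Finset.subset_univ _)
    (fun x _ => by
      refine ⟨Finset.univ.filter fun y => y.1 = x.1, by simp, ?_⟩
      simp only [Finset.mem_image, Finset.mem_univ, true_and]
      rintro _ ⟨⟨a, rfl⟩, hx⟩
      simp at hx
      simp [hx])
    (by
      simp only [Finset.mem_image, Finset.mem_univ, true_and, not_exists]
      intro a ha
      have : (⟨a, ⟨0, Nat.pos_of_ne_zero (hn a)⟩⟩ : Σ a, Fin (n a)) ∈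
          (∅ : Finset (Σ a, Fin (n a))) := by
        rw [← ha]; simp
      simp at this)

lemma fiber_card {α : Type} [Fintype α] [DecidableEq α] (n : α → ℕ) (a : α) :
    (Finset.univ.filter fun x : Σ a, Fin (n a) => x.1 = a).card = n a := by
  have : (Finset.univ.filter fun x : Σ a, Fin (n a) => x.1 = a) =
      Finset.univ.map (Function.Embedding.sigmaMk a) := by
    ext ⟨b, y⟩
    simp only [Finset.mem_filter, Finset.mem_univ, true_and, Finset.mem_map,
      Function.Embedding.sigmaMk_apply]
    constructor
    · rintro rfl
      exact ⟨y, rfl⟩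
    · rintro ⟨z, hz⟩
      exact (congrArg Sigma.fst hz).symm
  rw [this, Finset.card_map, Finset.card_univ, Fintype.card_fin]

lemma fiber_injective {α : Type} [Fintype α] [DecidableEq α] {n : α → ℕ} (hn : ∀ a, n a ≠ 0) :
    Function.Injective
      fun a => Finset.univ.filter fun x : Σ a, Fin (n a) => x.1 = a := by
  intro a b hab
  dsimp only at hab
  have : (⟨a, ⟨0, Nat.pos_of_ne_zero (hn a)⟩⟩ : Σ a, Fin (n a)) ∈
      Finset.univ.filter fun x : Σ a, Fin (n a) => x.1 = b := by
    rw [← hab]; simp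
  simpa using this

/-- Splitting a uniform choice into a choice with rational weights followed by uniform choices. -/
lemma uniformValue_sum (hinv : SupportInvariant H) (hgrp : Grouping H) {α : Type} [Fintype α]
    [Nonempty α] (n : α → ℕ) (hn : ∀ a, n a ≠ 0) :
    uniformValue H (∑ a, n a) =
      H α (fun a => (n a : ℝ) / ((∑ a, n a : ℕ) : ℝ)) +
        ∑ a, (n a : ℝ) / ((∑ a, n a : ℕ) : ℝ) * uniformValue H (n a) := by
  have := Classical.decEq α
  set N := ∑ a, n a with hN
  have hN0 : N ≠ 0 := by
    obtain ⟨a⟩ := ‹Nonempty α›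
    intro h
    exact hn a (Finset.sum_eq_zero_iff.mp h a (Finset.mem_univ a))
  have hNR : (0 : ℝ) < N := by positivity
  have hcard : Fintype.card (Σ a, Fin (n a)) = N := by simp [hN]
  have hpart (a : α) : ∑ x ∈ Finset.univ.filter (fun x : Σ a, Fin (n a) => x.1 = a),
      (N : ℝ)⁻¹ = n a / N := by
    rw [Finset.sum_const, fiber_card, nsmul_eq_mul, div_eq_mul_inv]
  rw [← hinv.eq_uniformValue hN0 hcard,
    hgrp _ _ (fun _ => by positivity) (by simp [← hN, hNR.ne']) (fiberPartition n hn)]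
  congr 1
  · symm
    refine hinv.congr_equiv (fun a => by positivity) ?_
      (Equiv.ofBijective (fun a => ⟨Finset.univ.filter fun x : Σ a, Fin (n a) => x.1 = a,
        Finset.mem_image_of_mem _ (Finset.mem_univ a)⟩) ⟨?_, ?_⟩) hpart
    · rw [← Finset.sum_div, ← Nat.cast_sum, ← hN, div_self hNR.ne']
    · intro a b hab
      exact fiber_injective hn (congrArg Subtype.val hab)
    · rintro ⟨E, hE⟩
      obtain ⟨a, -, rfl⟩ := Finset.mem_image.mp hE
      exact ⟨a, rfl⟩
  · refine (Finset.sum_image (fiber_injective hn).injOn).trans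
      (Finset.sum_congr rfl fun a _ => ?_)
    have ha : (0 : ℝ) < n a := by exact_mod_cast Nat.pos_of_ne_zero (hn a)
    rw [hpart, if_pos (by positivity)]
    congr 1
    rw [← hinv.eq_uniformValue (hn a) (Fintype.card_coe _ |>.trans (fiber_card n a))]
    congr 1
    ext
    field_simp

lemma uniformValue_mul (hinv : SupportInvariant H) (hgrp : Grouping H) {m n : ℕ}
    (hm : m ≠ 0) (hn : n ≠ 0) :
    uniformValue H (m * n) = uniformValue H m + uniformValue H n := by
  have : Nonempty (Fin m) := ⟨⟨0, Nat.pos_of_ne_zero hm⟩⟩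
  have hm' : (m : ℝ) ≠ 0 := by exact_mod_cast hm
  have hn' : (n : ℝ) ≠ 0 := by exact_mod_cast hn
  have h := uniformValue_sum hinv hgrp (fun _ : Fin m => n) fun _ => hn
  have hq : (n : ℝ) / (m * n) = (m : ℝ)⁻¹ := by field_simp
  simp only [Finset.sum_const, Finset.card_univ, Fintype.card_fin, smul_eq_mul,
    nsmul_eq_mul, Nat.cast_mul, hq, mul_inv_cancel_left₀ hm'] at h
  exact h

end Uniqueness

/-- A completely additive strictly monotone arithmetic function is a multiple of the logarithm. -/
lemma eq_const_mul_log_of_additive {L : ℕ → ℝ}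
    (hmul : ∀ m n : ℕ, m ≠ 0 → n ≠ 0 → L (m * n) = L m + L n)
    (hmono : ∀ n : ℕ, 1 ≤ n → L n < L (n + 1)) :
    ∃ C : ℝ, 0 < C ∧ ∀ n : ℕ, n ≠ 0 → L n = C * Real.log n := by
  have hone : L 1 = 0 := by
    have := hmul 1 1 one_ne_zero one_ne_zero
    simp at this
    exact this
  have hle {m n : ℕ} (hm : 1 ≤ m) (hmn : m ≤ n) : L m ≤ L n := by
    induction n, hmn using Nat.le_induction with
    | base => rfl
    | succ k hk ih => exact ih.trans (hmono k (hm.trans hk)).le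
  have hpow {n : ℕ} (hn : n ≠ 0) (k : ℕ) : L (n ^ k) = k * L n := by
    induction k with
    | zero => simp [hone]
    | succ k ih =>
      rw [pow_succ, hmul _ _ (pow_ne_zero k hn) hn, ih]
      push_cast
      ring
  have htwo : 0 < L 2 := hone ▸ hmono 1 le_rfl
  have hlog : 0 < Real.log 2 := Real.log_pos one_lt_two
  refine ⟨L 2 / Real.log 2, div_pos htwo hlog, fun n hn => ?_⟩
  have hbound (k : ℕ) : k * |L n * Real.log 2 - L 2 * Real.log n| ≤ L 2 * Real.log 2 := by
    have hnk : n ^ k ≠ 0 := pow_ne_zero k hn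
    set j := Nat.log 2 (n ^ k)
    have hj : 2 ^ j ≤ n ^ k := Nat.pow_log_le_self 2 hnk
    have hj' : n ^ k ≤ 2 ^ (j + 1) := (Nat.lt_pow_succ_log_self one_lt_two _).le
    have hlower := hle Nat.one_le_two_pow hj
    have hupper := hle (Nat.one_le_iff_ne_zero.mpr hnk) hj'
    have hlogLower : Real.log ((2 : ℝ) ^ j) ≤ Real.log ((n : ℝ) ^ k) :=
      Real.log_le_log (by positivity) (by exact_mod_cast hj)
    have hlogUpper : Real.log ((n : ℝ) ^ k) ≤ Real.log ((2 : ℝ) ^ (j + 1)) :=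
      Real.log_le_log (by positivity) (by exact_mod_cast hj')
    rw [hpow two_ne_zero, hpow hn] at hlower
    rw [hpow two_ne_zero, hpow hn] at hupper
    rw [Real.log_pow, Real.log_pow] at hlogLower hlogUpper
    push_cast at hupper hlogUpper
    rw [← Nat.abs_cast k, ← abs_mul, abs_le]
    constructor <;> nlinarith
  have hzero : |L n * Real.log 2 - L 2 * Real.log n| = 0 := by
    by_contra hne
    have hpos := lt_of_le_of_ne (abs_nonneg _) (Ne.symm hne)
    obtain ⟨k, hk⟩ := exists_nat_gt (L 2 * Real.log 2 / |L n * Real.log 2 - L 2 * Real.log n|)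
    exact absurd (hbound k) (not_le.mpr ((div_lt_iff₀ hpos).mp hk))
  rw [abs_eq_zero] at hzero
  field_simp
  linarith

lemma continuous_shannonEntropy {α : Type} [Fintype α] :
    Continuous (shannonEntropy : (α → ℝ) → ℝ) := by
  unfold shannonEntropy
  fun_prop

/-- Every probability vector is a limit of probability vectors with positive rational entries. -/
lemma exists_tendsto_rational {α : Type} [Fintype α] {p : α → ℝ} (hp : ∀ i, 0 ≤ p i)
    (hsum : ∑ i, p i = 1) :
    ∃ n : ℕ → α → ℕ, (∀ k a, n k a ≠ 0) ∧
      Filter.Tendsto (fun k a => (n k a : ℝ) / ((∑ a, n k a : ℕ) : ℝ)) Filter.atTop (nhds p) := by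
  refine ⟨fun k a => ⌊p a * k⌋₊ + 1, fun _ _ => Nat.succ_ne_zero _, ?_⟩
  have hnum (a : α) : Filter.Tendsto (fun k : ℕ => ((⌊p a * k⌋₊ + 1 : ℕ) : ℝ) / k)
      Filter.atTop (nhds (p a)) := by
    have h := ((tendsto_nat_floor_mul_div_atTop (hp a)).comp
      tendsto_natCast_atTop_atTop).add (tendsto_one_div_atTop_nhds_zero_nat (𝕜 := ℝ))
    rw [add_zero] at h
    refine h.congr fun k => ?_
    simp [add_div]
  have hden : Filter.Tendsto (fun k : ℕ => ((∑ a, (⌊p a * k⌋₊ + 1) : ℕ) : ℝ) / k)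
      Filter.atTop (nhds 1) := by
    rw [← hsum]
    refine (tendsto_finsetSum Finset.univ fun a _ => hnum a).congr fun k => ?_
    rw [Nat.cast_sum, Finset.sum_div]
  refine tendsto_pi_nhds.mpr fun a => ?_
  have h := (hnum a).div hden one_ne_zero
  rw [div_one] at h
  refine h.congr' ?_
  filter_upwards [Filter.eventually_ne_atTop 0] with k hk
  exact div_div_div_cancel_right₀ (Nat.cast_ne_zero.mpr hk) _ _

lemma shannonEntropy_rational {α : Type} [Fintype α] [Nonempty α] (n : α → ℕ)
    (hn : ∀ a, n a ≠ 0) :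
    shannonEntropy (fun a => (n a : ℝ) / ((∑ a, n a : ℕ) : ℝ)) =
      Real.log ((∑ a, n a : ℕ) : ℝ) -
        ∑ a, (n a : ℝ) / ((∑ a, n a : ℕ) : ℝ) * Real.log (n a) := by
  have hN : ((∑ a, n a : ℕ) : ℝ) ≠ 0 := by
    obtain ⟨a⟩ := ‹Nonempty α›
    exact Nat.cast_ne_zero.mpr fun h =>
      hn a (Finset.sum_eq_zero_iff.mp h a (Finset.mem_univ a))
  have hone : ∑ a, (n a : ℝ) / ((∑ a, n a : ℕ) : ℝ) = 1 := by
    rw [← Finset.sum_div, ← Nat.cast_sum, div_self hN]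
  rw [← one_mul (Real.log ((∑ a, n a : ℕ) : ℝ)), ← hone, Finset.sum_mul,
    ← Finset.sum_sub_distrib]
  refine Finset.sum_congr rfl fun a _ => ?_
  rw [Real.negMulLog, Real.log_div (Nat.cast_ne_zero.mpr (hn a)) hN]
  ring

/-- The four axioms force `H` to be a positive multiple of Shannon entropy. -/
lemma exists_eq_const_mul_shannonEntropy {H : ∀ (α : Type) [Fintype α], (α → ℝ) → ℝ}
    (hinv : SupportInvariant H)
    (hcont : ∀ (α : Type) [Fintype α],
      ContinuousOn (H α) {p : α → ℝ | (∀ i, 0 ≤ p i) ∧ ∑ i, p i = 1})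
    (hmono : ∀ n : ℕ, 1 ≤ n → uniformValue H n < uniformValue H (n + 1))
    (hgrp : Grouping H) :
    ∃ C : ℝ, 0 < C ∧ ∀ (α : Type) [Fintype α] (p : α → ℝ),
      (∀ i, 0 ≤ p i) → ∑ i, p i = 1 → H α p = C * shannonEntropy p := by
  obtain ⟨C, hC, hL⟩ := eq_const_mul_log_of_additive
    (fun m n hm hn => uniformValue_mul hinv hgrp hm hn) hmono
  refine ⟨C, hC, fun α _ p hp hsum => ?_⟩
  have : Nonempty α := by
    by_contra h
    rw [not_nonempty_iff] at h
    simp at hsum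
  obtain ⟨n, hn, hlim⟩ := exists_tendsto_rational hp hsum
  have hN (k : ℕ) : (∑ a, n k a) ≠ 0 := by
    obtain ⟨a⟩ := ‹Nonempty α›
    exact fun h => hn k a (Finset.sum_eq_zero_iff.mp h a (Finset.mem_univ a))
  have hmem (k : ℕ) : (fun a => (n k a : ℝ) / ((∑ a, n k a : ℕ) : ℝ)) ∈
      {p : α → ℝ | (∀ i, 0 ≤ p i) ∧ ∑ i, p i = 1} := by
    refine ⟨fun a => by positivity, ?_⟩
    rw [← Finset.sum_div, ← Nat.cast_sum, div_self (Nat.cast_ne_zero.mpr (hN k))]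
  have hrat (k : ℕ) : H α (fun a => (n k a : ℝ) / ((∑ a, n k a : ℕ) : ℝ)) =
      C * shannonEntropy (fun a => (n k a : ℝ) / ((∑ a, n k a : ℕ) : ℝ)) := by
    have h := uniformValue_sum hinv hgrp (n k) (hn k)
    simp only [hL _ (hN k), hL _ (hn k _)] at h
    rw [shannonEntropy_rational _ (hn k), mul_sub, h, Finset.mul_sum, eq_sub_iff_add_eq]
    congr 1
    exact Finset.sum_congr rfl fun a _ => by ring
  have hleft := (hcont α p ⟨hp, hsum⟩).tendsto.comp
    (tendsto_nhdsWithin_iff.mpr ⟨hlim, Filter.Eventually.of_forall hmem⟩)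
  have hright := ((continuous_shannonEntropy.tendsto p).comp hlim).const_mul C
  exact tendsto_nhds_unique (hleft.congr hrat) hright

lemma sum_pos_mul_logb {α : Type} [Fintype α] (b : ℝ) {p : α → ℝ} (hp : ∀ i, 0 ≤ p i) :
    ∑ i ∈ Finset.univ.filter (fun i => 0 < p i), p i * Real.logb b (p i) =
      -(shannonEntropy p / Real.log b) := by
  rw [Finset.sum_filter_of_ne, shannonEntropy, Finset.sum_div, ← Finset.sum_neg_distrib]
  · refine Finset.sum_congr rfl fun i _ => ?_
    rw [Real.negMulLog, Real.logb]
    ring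
  · intro i _ hi
    exact lt_of_le_of_ne (hp i) fun h => hi (by rw [← h, zero_mul])

lemma shannonEntropy_eq_sum_support {α : Type} [Fintype α] {p : α → ℝ} (hp : ∀ i, 0 ≤ p i) :
    shannonEntropy p = ∑ i : {i : α // 0 < p i}, Real.negMulLog (p i) := by
  rw [shannonEntropy, ← Finset.sum_subtype (Finset.univ.filter fun i => 0 < p i) (by simp)
    fun i => Real.negMulLog (p i), Finset.sum_filter_of_ne]
  intro i _ hi
  exact lt_of_le_of_ne (hp i) fun h => hi (by rw [← h, Real.negMulLog_zero])

lemma shannonEntropy_uniform {n : ℕ} (hn : n ≠ 0) :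
    shannonEntropy (fun _ : Fin n => (n : ℝ)⁻¹) = Real.log n := by
  have : (n : ℝ) ≠ 0 := Nat.cast_ne_zero.mpr hn
  simp [shannonEntropy, Real.negMulLog, this]

lemma sum_negMulLog_eq_add {α : Type} (E : Finset α) {p : α → ℝ} (hp : ∀ i, 0 ≤ p i) :
    ∑ i ∈ E, Real.negMulLog (p i) = Real.negMulLog (∑ i ∈ E, p i) +
      if 0 < ∑ i ∈ E, p i then
        (∑ i ∈ E, p i) * shannonEntropy (fun i : E => p i.1 / ∑ i' ∈ E, p i')
      else 0 := by
  split_ifs with hP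
  · set P := ∑ i ∈ E, p i with hPdef
    have hterm (i : α) : P * Real.negMulLog (p i / P) =
        Real.negMulLog (p i) + p i * Real.log P := by
      rcases eq_or_ne (p i) 0 with hi | hi
      · simp [hi]
      · rw [Real.negMulLog, Real.negMulLog, Real.log_div hi hP.ne']
        field_simp
        ring
    rw [shannonEntropy, Finset.sum_coe_sort E fun i => Real.negMulLog (p i / P),
      Finset.mul_sum, Finset.sum_congr rfl fun i _ => hterm i, Finset.sum_add_distrib,
      ← Finset.sum_mul, ← hPdef, Real.negMulLog]
    ring
  · have hzero : ∑ i ∈ E, p i = 0 :=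
      le_antisymm (not_lt.mp hP) (Finset.sum_nonneg fun i _ => hp i)
    have hall := (Finset.sum_eq_zero_iff_of_nonneg fun i _ => hp i).mp hzero
    rw [hzero, Real.negMulLog_zero, add_zero]
    exact Finset.sum_eq_zero fun i hi => by rw [hall i hi, Real.negMulLog_zero]

lemma sum_parts {α : Type} [Fintype α] [DecidableEq α] (f : α → ℝ)
    (𝓔 : Finpartition (Finset.univ : Finset α)) :
    ∑ E ∈ 𝓔.parts, ∑ i ∈ E, f i = ∑ i, f i := by
  have h := Finset.sum_biUnion (f := f) 𝓔.disjoint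
  rw [𝓔.biUnion_parts] at h
  exact h.symm

lemma shannonEntropy_grouping {α : Type} [Fintype α] [DecidableEq α] {p : α → ℝ}
    (hp : ∀ i, 0 ≤ p i) (𝓔 : Finpartition (Finset.univ : Finset α)) :
    shannonEntropy p = shannonEntropy (fun E : 𝓔.parts => ∑ i ∈ E.1, p i) +
      ∑ E ∈ 𝓔.parts,
        if 0 < ∑ i ∈ E, p i then
          (∑ i ∈ E, p i) * shannonEntropy (fun i : E => p i.1 / ∑ i' ∈ E, p i')
        else 0 := by
  rw [shannonEntropy, shannonEntropy,
    Finset.sum_coe_sort 𝓔.parts fun E => Real.negMulLog (∑ i ∈ E, p i),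
    ← Finset.sum_add_distrib, ← Finset.sum_congr rfl fun E _ => sum_negMulLog_eq_add E hp,
    sum_parts]

lemma sum_parts_eq_one {α : Type} [Fintype α] [DecidableEq α] {p : α → ℝ}
    (hsum : ∑ i, p i = 1) (𝓔 : Finpartition (Finset.univ : Finset α)) :
    ∑ E : 𝓔.parts, ∑ i ∈ E.1, p i = 1 := by
  rw [Finset.sum_coe_sort 𝓔.parts fun E => ∑ i ∈ E, p i,
    sum_parts, hsum]

/-- Existence and uniqueness of entropy (Shannon): a functional `H` on finite
probability vectors satisfies the four axioms (invariance under
probability-preserving bijections of supports, continuity on the simplex,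
strict monotonicity on uniform distributions, and the grouping axiom) if and
only if it is of the form `H(p) = -K Σ_{i : p i > 0} p i * log_b (p i)` for
some constants `K > 0` and `b > 1`. -/
theorem entropy_existence_uniqueness
    (H : ∀ (α : Type) [Fintype α], (α → ℝ) → ℝ) :
    ((∀ (α : Type) [Fintype α] (β : Type) [Fintype β] (p : α → ℝ) (p' : β → ℝ),
        (∀ i, 0 ≤ p i) → ∑ i, p i = 1 → (∀ j, 0 ≤ p' j) → ∑ j, p' j = 1 →
        ∀ f : {i : α // 0 < p i} ≃ {j : β // 0 < p' j},
          (∀ i, p' (f i).1 = p i.1) → H α p = H β p') ∧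
      (∀ (α : Type) [Fintype α],
        ContinuousOn (H α) {p : α → ℝ | (∀ i, 0 ≤ p i) ∧ ∑ i, p i = 1}) ∧
      (∀ n : ℕ, 1 ≤ n →
        H (Fin n) (fun _ => (n : ℝ)⁻¹) <
          H (Fin (n + 1)) (fun _ => ((n : ℝ) + 1)⁻¹)) ∧
      (∀ (α : Type) [Fintype α] [DecidableEq α] (p : α → ℝ),
        (∀ i, 0 ≤ p i) → ∑ i, p i = 1 →
        ∀ 𝓔 : Finpartition (Finset.univ : Finset α),
          H α p = H ↥𝓔.parts (fun E => ∑ i ∈ E.1, p i) +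
            ∑ E ∈ 𝓔.parts,
              (if 0 < ∑ i ∈ E, p i then
                (∑ i ∈ E, p i) * H ↥E (fun i => p i.1 / ∑ i' ∈ E, p i')
              else 0)))
    ↔ (∃ K : ℝ, 0 < K ∧ ∃ b : ℝ, 1 < b ∧
        ∀ (α : Type) [Fintype α] (p : α → ℝ),
          (∀ i, 0 ≤ p i) → ∑ i, p i = 1 →
          H α p = -K * ∑ i ∈ Finset.univ.filter (fun i => 0 < p i),
            p i * Real.logb b (p i)) := by
  constructor
  · rintro ⟨hinv, hcont, hmono, hgrp⟩
    obtain ⟨C, hC, hH⟩ := exists_eq_const_mul_shannonEntropy hinv hcont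
      (fun n hn => by simpa [uniformValue] using hmono n hn) hgrp
    refine ⟨C, hC, Real.exp 1, Real.one_lt_exp_iff.mpr one_pos, fun α _ p hp hsum => ?_⟩
    rw [hH α p hp hsum, sum_pos_mul_logb _ hp, Real.log_exp]
    ring
  · rintro ⟨K, hK, b, hb, hform⟩
    obtain ⟨C, hC, hH⟩ : ∃ C : ℝ, 0 < C ∧ ∀ (α : Type) [Fintype α] (p : α → ℝ),
        (∀ i, 0 ≤ p i) → ∑ i, p i = 1 → H α p = C * shannonEntropy p := by
      refine ⟨K / Real.log b, div_pos hK (Real.log_pos hb), fun α _ p hp hsum => ?_⟩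
      rw [hform α p hp hsum, sum_pos_mul_logb _ hp]
      ring
    refine ⟨?_, ?_, ?_, ?_⟩
    · intro α _ β _ p p' hp hsum hp' hsum' f hf
      rw [hH α p hp hsum, hH β p' hp' hsum', shannonEntropy_eq_sum_support hp,
        shannonEntropy_eq_sum_support hp', ← f.sum_comp]
      simp only [hf]
    · intro α _
      exact (continuous_shannonEntropy.const_mul C).continuousOn.congr
        fun p hp => hH α p hp.1 hp.2
    · intro n hn
      have hn' : (0 : ℝ) < n := by exact_mod_cast hn
      have hval (m : ℕ) (hm : m ≠ 0) : H (Fin m) (fun _ => (m : ℝ)⁻¹) = C * Real.log m := by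
        have : (m : ℝ) ≠ 0 := Nat.cast_ne_zero.mpr hm
        rw [hH _ _ (fun _ => by positivity) (by simp [this]), shannonEntropy_uniform hm]
      have hsucc := hval (n + 1) n.succ_ne_zero
      push_cast at hsucc
      rw [hval n (by omega), hsucc]
      exact mul_lt_mul_of_pos_left (Real.log_lt_log hn' (lt_add_one _)) hC
    · intro α _ _ p hp hsum 𝓔
      rw [hH α p hp hsum, hH 𝓔.parts _ (fun E => Finset.sum_nonneg fun i _ => hp i)
        (sum_parts_eq_one hsum 𝓔), shannonEntropy_grouping hp 𝓔, mul_add, Finset.mul_sum]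
      congr 1
      refine Finset.sum_congr rfl fun E _ => ?_
      split_ifs with hP
      · rw [hH E _ (fun i => div_nonneg (hp _) hP.le)]
        · ring
        · rw [← Finset.sum_div, Finset.sum_coe_sort E p, div_self hP.ne']
      · rw [mul_zero]
end
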